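/- arXiv:1904.01436 — 2 statements merged into one kernel-verified Lean document; each statement's English description precedes it below -/
import Mathlib

section
/- For every subset A ⊆ {1,…,n−1}, the permutation π(A) = ⋁_{i∈A} g_i satisfies ID(π(A)) = A, and for every q ∈ Sym(n) with ID(q) = A one has π(A) ≼ q and Inv(π(A)) ⊆ Inv(q); hence π(A) is the unique ≼-minimum permutation whose inverse descent set equals A. -/
/-- The inversion set of a permutation `p` of `{0,…,n-1}` (0-indexed version of
`Inv(p) = {(p_j, p_i) : i < j, p_j < p_i}`): pairs `(a, b)` of values with `a < b`
such that `b` precedes `a` in the one-line notation of `p`. -/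
def InvSet (n : ℕ) (p : Equiv.Perm (Fin n)) : Finset (Fin n × Fin n) :=
  Finset.univ.filter (fun x => x.1 < x.2 ∧ p.symm x.2 < p.symm x.1)

/-- The weak (right) Bruhat order: `p ≼ q` iff `Inv(p) ⊆ Inv(q)`. -/
def BLE {n : ℕ} (p q : Equiv.Perm (Fin n)) : Prop :=
  InvSet n p ⊆ InvSet n q

/-- The rank of a permutation in the weak Bruhat order: `rank(p) = |Inv(p)|`. -/
def brank (n : ℕ) (p : Equiv.Perm (Fin n)) : ℕ :=
  (InvSet n p).card

/-- The inverse descent set `ID(p) ⊆ {1,…,n-1}`: `i ∈ ID(p)` iff the (1-indexed)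
value `i+1` precedes the value `i` in the one-line notation of `p`.  Here the
1-indexed value `v ∈ {1,…,n}` corresponds to the element of `Fin n` with `val = v - 1`. -/
def ID (n : ℕ) (p : Equiv.Perm (Fin n)) : Finset ℕ :=
  (Finset.Icc 1 (n - 1)).filter
    (fun i => ∃ a b : Fin n, (a : ℕ) + 1 = i ∧ (b : ℕ) = i ∧ p.symm b < p.symm a)

/-- The generator `g i` is the adjacent transposition interchanging the
(1-indexed) values `i` and `i+1`. -/
def g (n i : ℕ) : Equiv.Perm (Fin n) :=
  if h : 1 ≤ i ∧ i < n then Equiv.swap ⟨i - 1, by omega⟩ ⟨i, h.2⟩ else 1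

/-- A family of permutations is intersecting if any two of its members have
meet different from the identity in the weak Bruhat lattice; equivalently (since the
identity is the minimum), any two members have a common lower bound distinct
from the identity. -/
def BInter (n : ℕ) (P : Set (Equiv.Perm (Fin n))) : Prop :=
  ∀ p ∈ P, ∀ q ∈ P, ∃ r : Equiv.Perm (Fin n), r ≠ 1 ∧ BLE r p ∧ BLE r q

/-- A maximal intersecting family: intersecting, and every permutation
intersecting all its members belongs to it. -/
def MaxBInter (n : ℕ) (P : Set (Equiv.Perm (Fin n))) : Prop :=
  BInter n P ∧ ∀ q : Equiv.Perm (Fin n),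
    (∀ p ∈ P, ∃ r : Equiv.Perm (Fin n), r ≠ 1 ∧ BLE r q ∧ BLE r p) → q ∈ P

/-- The set of `≼`-minimal elements of a family `P`. -/
def minSet (n : ℕ) (P : Set (Equiv.Perm (Fin n))) : Set (Equiv.Perm (Fin n)) :=
  {p | p ∈ P ∧ ∀ q ∈ P, BLE q p → q = p}

/-- `m` is the meet (greatest lower bound) of `p` and `q` in the weak Bruhat order. -/
def IsMeetB (n : ℕ) (p q m : Equiv.Perm (Fin n)) : Prop :=
  BLE m p ∧ BLE m q ∧ ∀ r, BLE r p → BLE r q → BLE r m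

/-- `m` is the join (least upper bound) of the set `S` in the weak Bruhat order. -/
def IsLUBB (n : ℕ) (S : Set (Equiv.Perm (Fin n))) (m : Equiv.Perm (Fin n)) : Prop :=
  (∀ s ∈ S, BLE s m) ∧ ∀ u, (∀ s ∈ S, BLE s u) → BLE m u

/-- For a system `𝒜` of subsets of `{1,…,n-1}`,
`P(𝒜) = {p : A ⊆ ID(p) for some A ∈ 𝒜}`. -/
def PofSystem (n : ℕ) (𝒜 : Set (Finset ℕ)) : Set (Equiv.Perm (Fin n)) :=
  {p | ∃ A ∈ 𝒜, A ⊆ ID n p}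

/-- The generating set system of a family `P`: `{ID(p) : p ∈ min(P)}`. -/
def genSys (n : ℕ) (P : Set (Equiv.Perm (Fin n))) : Set (Finset ℕ) :=
  {A | ∃ p ∈ minSet n P, ID n p = A}

/-- A maximal intersecting antichain of subsets of `{1,…,n-1}`: an antichain
under inclusion, any two members of which meet, such that for every subset `B`
of `{1,…,n-1}` not in the system there is a member `A` with `A ∩ B = ∅` or `A ⊆ B`. -/
def MIA (n : ℕ) (𝒜 : Set (Finset ℕ)) : Prop :=
  (∀ A ∈ 𝒜, ∀ B ∈ 𝒜, A ⊆ B → A = B) ∧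
  (∀ A ∈ 𝒜, ∀ B ∈ 𝒜, (A ∩ B).Nonempty) ∧
  (∀ B : Finset ℕ, B ⊆ Finset.Icc 1 (n - 1) → B ∉ 𝒜 → ∃ A ∈ 𝒜, A ∩ B = ∅ ∨ A ⊆ B)

theorem mem_InvSet_iff {n : ℕ} {p : Equiv.Perm (Fin n)} {a b : Fin n} :
    (a, b) ∈ InvSet n p ↔ a < b ∧ p.symm b < p.symm a := by
  simp [InvSet]

theorem mem_ID_iff {n : ℕ} {p : Equiv.Perm (Fin n)} {i : ℕ} :
    i ∈ ID n p ↔ ∃ a b : Fin n, (a : ℕ) + 1 = i ∧ (b : ℕ) = i ∧ p.symm b < p.symm a := by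
  simp only [ID, Finset.mem_filter, Finset.mem_Icc, and_iff_right_iff_imp]
  rintro ⟨a, b, ha, hb, -⟩
  have := b.isLt
  omega

/-- A permutation is determined by its inversion set. -/
theorem InvSet_injective (n : ℕ) : Function.Injective (InvSet n) := by
  intro p q h
  have key : ∀ a b : Fin n, a < b → (p.symm b < p.symm a ↔ q.symm b < q.symm a) := by
    intro a b hab
    have := congrArg ((a, b) ∈ ·) h
    simpa [mem_InvSet_iff, hab] using this
  have mono : StrictMono (q.symm ∘ p) := by
    intro x y hxy
    rcases lt_trichotomy (p x) (p y) with hlt | heq | hgt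
    · have h1 := key _ _ hlt
      have hne : q.symm (p x) ≠ q.symm (p y) := by simpa using hxy.ne
      simp only [Equiv.symm_apply_apply] at h1
      exact lt_of_le_of_ne (not_lt.mp fun h2 => lt_asymm hxy (h1.mpr h2)) hne
    · exact absurd (p.injective heq) hxy.ne
    · simpa [hxy] using key _ _ hgt
  have hid : q.symm ∘ p = id :=
    (StrictMono.range_inj mono strictMono_id).mp (by
      rw [(q.symm.surjective.comp p.surjective).range_eq, Set.range_id])
  ext1 x
  simpa [Equiv.symm_apply_eq] using congrFun hid x

/-- The only inversion of an adjacent transposition is the transposed pair. -/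
theorem mem_InvSet_g_iff {n i : ℕ} (hi : 1 ≤ i ∧ i < n) {a b : Fin n} :
    (a, b) ∈ InvSet n (g n i) ↔ (a : ℕ) + 1 = i ∧ (b : ℕ) = i := by
  rw [mem_InvSet_iff]
  simp only [g, hi, and_self, dite_true, Equiv.symm_swap, Equiv.swap_apply_def, Fin.ext_iff,
    Fin.lt_def]
  split_ifs <;> (try dsimp only) <;> omega

theorem mem_ID_iff_g_BLE {n i : ℕ} (hi : 1 ≤ i ∧ i < n) {p : Equiv.Perm (Fin n)} :
    i ∈ ID n p ↔ BLE (g n i) p := by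
  rw [mem_ID_iff]
  constructor
  · rintro ⟨a, b, ha, hb, hp⟩ ⟨c, d⟩ hcd
    obtain ⟨hc, hd⟩ := (mem_InvSet_g_iff hi).mp hcd
    obtain rfl : c = a := Fin.ext (by omega)
    obtain rfl : d = b := Fin.ext (by omega)
    exact mem_InvSet_iff.mpr ⟨Fin.lt_def.mpr (by omega), hp⟩
  · intro h
    have hmem := h ((mem_InvSet_g_iff hi (a := ⟨i - 1, by omega⟩) (b := ⟨i, hi.2⟩)).mpr
      ⟨by simp only []; omega, rfl⟩)
    exact ⟨⟨i - 1, by omega⟩, ⟨i, hi.2⟩, by simp only []; omega, rfl, (mem_InvSet_iff.mp hmem).2⟩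

/-- A chain of consecutive inverse descents gives an inversion. -/
theorem symm_lt_symm_of_forall_mem_ID {n : ℕ} {p : Equiv.Perm (Fin n)} {a b : Fin n} (hab : a < b)
    (h : ∀ i, (a : ℕ) < i → i ≤ b → i ∈ ID n p) : p.symm b < p.symm a := by
  obtain ⟨b, hb⟩ := b
  induction b with
  | zero => exact absurd hab (by simp [Fin.lt_def])
  | succ k ih =>
    obtain ⟨c, d, hc, hd, hlt⟩ := mem_ID_iff.mp (h (k + 1) hab le_rfl)
    have hk : k < n := Nat.lt_of_succ_lt hb
    rw [show c = ⟨k, hk⟩ from Fin.ext (Nat.succ_injective hc),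
      show d = ⟨k + 1, hb⟩ from Fin.ext hd] at hlt
    rcases (Nat.lt_succ_iff_lt_or_eq.mp hab) with hak | hak
    · exact hlt.trans (ih hk hak fun i h1 h2 => h i h1 (Nat.le_succ_of_le h2))
    · rwa [show a = ⟨k, hk⟩ from Fin.ext hak]

/-- Counting the elements of `{1,…,a}` outside `A` numbers the blocks of consecutive integers
that are joined by the elements of `A`. -/
theorem card_Icc_sdiff_le_iff (A : Finset ℕ) {a b : ℕ} (hab : a ≤ b) :
    (Finset.Icc 1 b \ A).card ≤ (Finset.Icc 1 a \ A).card ↔ ∀ i, a < i → i ≤ b → i ∈ A := by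
  have hsub : Finset.Icc 1 a \ A ⊆ Finset.Icc 1 b \ A :=
    Finset.sdiff_subset_sdiff (Finset.Icc_subset_Icc_right hab) le_rfl
  constructor
  · intro h i hai hib
    by_contra hi
    have : i ∈ Finset.Icc 1 a \ A := by
      rw [Finset.eq_of_subset_of_card_le hsub h]
      simp only [Finset.mem_sdiff, Finset.mem_Icc]
      exact ⟨by omega, hi⟩
    simp only [Finset.mem_sdiff, Finset.mem_Icc] at this
    omega
  · intro h
    refine Finset.card_le_card fun i hi => ?_
    simp only [Finset.mem_sdiff, Finset.mem_Icc] at hi ⊢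
    exact ⟨⟨hi.1.1, not_lt.mp fun hai => hi.2 (h i hai hi.1.2)⟩, hi.2⟩

/-- There is a permutation which reverses every block of consecutive integers joined by the
elements of `A`, and has no other inversions. -/
theorem exists_perm_mem_InvSet_iff (n : ℕ) (A : Finset ℕ) :
    ∃ m : Equiv.Perm (Fin n), ∀ a b : Fin n,
      (a, b) ∈ InvSet n m ↔ a < b ∧ ∀ i, (a : ℕ) < i → i ≤ b → i ∈ A := by
  let f : Fin n → ℕ ×ₗ (Fin n)ᵒᵈ := fun a =>
    toLex ((Finset.Icc 1 (a : ℕ) \ A).card, OrderDual.toDual a)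
  have hf : Function.Injective f := fun a b h => OrderDual.toDual.injective (congrArg (fun x => (ofLex x).2) h)
  have hmono : StrictMono (f ∘ Tuple.sort f) :=
    (Tuple.monotone_sort f).strictMono_of_injective (hf.comp (Tuple.sort f).injective)
  have hlt : ∀ a b, (Tuple.sort f).symm b < (Tuple.sort f).symm a ↔ f b < f a := fun a b => by
    rw [← hmono.lt_iff_lt]
    simp
  refine ⟨Tuple.sort f, fun a b => ?_⟩
  rw [mem_InvSet_iff, hlt]
  refine and_congr_right fun hab => ?_
  rw [← card_Icc_sdiff_le_iff A (Fin.le_def.mp hab.le), le_iff_lt_or_eq]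
  simp [f, Prod.Lex.toLex_lt_toLex, hab]

/-- For any `A ⊆ {1,…,n-1}`, the join `π(A) = ⋁_{i ∈ A} g_i` exists in the weak
Bruhat order, satisfies `ID(π(A)) = A`, and is the unique `≼`-minimum permutation
whose inverse descent set equals `A`: every `q` with `ID(q) = A` satisfies
`π(A) ≼ q` and `Inv(π(A)) ⊆ Inv(q)`. -/
theorem stmt_5 (n : ℕ) (A : Finset ℕ) (hA : A ⊆ Finset.Icc 1 (n - 1)) :
    ∃ m : Equiv.Perm (Fin n),
      IsLUBB n {s | ∃ i ∈ A, s = g n i} m ∧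
      ID n m = A ∧
      (∀ q : Equiv.Perm (Fin n), ID n q = A → BLE m q ∧ InvSet n m ⊆ InvSet n q) ∧
      (∀ q : Equiv.Perm (Fin n), ID n q = A → (∀ r, ID n r = A → BLE q r) → q = m) := by
  have hA' : ∀ i ∈ A, 1 ≤ i ∧ i < n := fun i hi => by
    have := Finset.mem_Icc.mp (hA hi)
    omega
  obtain ⟨m, hm⟩ := exists_perm_mem_InvSet_iff n A
  have hID : ID n m = A := by
    ext i
    constructor
    · intro hi
      obtain ⟨a, b, ha, hb, hlt⟩ := mem_ID_iff.mp hi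
      exact ((hm a b).mp (mem_InvSet_iff.mpr ⟨Fin.lt_def.mpr (by omega), hlt⟩)).2 i
        (by omega) hb.ge
    · intro hi
      rw [mem_ID_iff_g_BLE (hA' i hi)]
      rintro ⟨a, b⟩ hab
      obtain ⟨ha, hb⟩ := (mem_InvSet_g_iff (hA' i hi)).mp hab
      refine (hm a b).mpr ⟨Fin.lt_def.mpr (by omega), fun j h1 h2 => ?_⟩
      obtain rfl : j = i := by omega
      exact hi
  have hmin : ∀ q : Equiv.Perm (Fin n), A ⊆ ID n q → BLE m q := by
    rintro q hq ⟨a, b⟩ hab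
    obtain ⟨hlt, h⟩ := (hm a b).mp hab
    exact mem_InvSet_iff.mpr
      ⟨hlt, symm_lt_symm_of_forall_mem_ID hlt fun i h1 h2 => hq (h i h1 h2)⟩
  refine ⟨m, ⟨?_, fun u hu => hmin u fun i hi => ?_⟩, hID,
    fun q hq => ⟨hmin q hq.ge, hmin q hq.ge⟩,
    fun q hq h => InvSet_injective n (Finset.Subset.antisymm (h m hID) (hmin q hq.ge))⟩
  · rintro _ ⟨i, hi, rfl⟩
    exact (mem_ID_iff_g_BLE (hA' i hi)).mp (hID.ge hi)
  · exact (mem_ID_iff_g_BLE (hA' i hi)).mpr (hu _ ⟨i, hi, rfl⟩)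
end

section
/- For every integer n ≥ 2, the maximum size of an intersecting family P ⊆ B(n) is n!/2; moreover, for every permutation p of rank 1, the up-set {q ∈ Sym(n) : p ≼ q} is an intersecting family of size exactly n!/2. Consequently the weak Bruhat lattice B(n) has the EKR property. -/
theorem mem_InvSet {n : ℕ} {p : Equiv.Perm (Fin n)} {x : Fin n × Fin n} :
    x ∈ InvSet n p ↔ x.1 < x.2 ∧ p.symm x.2 < p.symm x.1 := by
  simp [InvSet]

theorem InvSet_one (n : ℕ) : InvSet n 1 = ∅ := by
  ext x
  simp only [mem_InvSet, Finset.notMem_empty, iff_false, not_and, not_lt]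
  exact fun h => h.le

theorem eq_one_of_InvSet_eq_empty {n : ℕ} {p : Equiv.Perm (Fin n)} (h : InvSet n p = ∅) :
    p = 1 := by
  have hmono : StrictMono p.symm := by
    intro a b hab
    have hnot : (a, b) ∉ InvSet n p := by simp [h]
    rw [mem_InvSet] at hnot
    exact lt_of_le_of_ne (not_lt.1 fun hlt => hnot ⟨hab, hlt⟩)
      fun heq => hab.ne (p.symm.injective heq)
  have hid : (p.symm : Fin n → Fin n) = id :=
    (hmono.range_inj strictMono_id).1 (by simp [p.symm.surjective.range_eq])
  ext1 x
  simpa using congrFun hid (p x) |>.symm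

/-- Reversing the one-line notation complements the inversion set. -/
theorem mem_InvSet_mul_revPerm {n : ℕ} {p : Equiv.Perm (Fin n)} {x : Fin n × Fin n}
    (hx : x.1 < x.2) : x ∈ InvSet n (p * Fin.revPerm) ↔ x ∉ InvSet n p := by
  have hne : p.symm x.1 ≠ p.symm x.2 := fun h => hx.ne (p.symm.injective h)
  have hsymm (y : Fin n) : (p * Fin.revPerm).symm y = (p.symm y).rev := rfl
  simp only [mem_InvSet, hx, true_and, hsymm, Fin.rev_lt_rev, not_lt]
  exact ⟨le_of_lt, fun h => lt_of_le_of_ne h hne⟩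

theorem not_common_lower_bound_mul_revPerm {n : ℕ} {p r : Equiv.Perm (Fin n)}
    (hp : BLE r p) (hrev : BLE r (p * Fin.revPerm)) : r = 1 := by
  refine eq_one_of_InvSet_eq_empty (Finset.eq_empty_of_forall_notMem fun x hx => ?_)
  exact (mem_InvSet_mul_revPerm (mem_InvSet.1 hx).1).1 (hrev hx) (hp hx)

theorem ncard_image_mul_revPerm {n : ℕ} (P : Set (Equiv.Perm (Fin n))) :
    ((· * Fin.revPerm) '' P).ncard = P.ncard :=
  Set.ncard_image_of_injective _ (mul_left_injective _)

theorem BInter.two_mul_ncard_le {n : ℕ} {P : Set (Equiv.Perm (Fin n))} (hP : BInter n P) :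
    2 * P.ncard ≤ n.factorial := by
  have hdisj : Disjoint P ((· * Fin.revPerm) '' P) := by
    rw [Set.disjoint_left]
    rintro _ hq ⟨p, hp, rfl⟩
    obtain ⟨r, hr, hrp, hrq⟩ := hP p hp _ hq
    exact hr (not_common_lower_bound_mul_revPerm hrp hrq)
  have hunion := Set.ncard_union_eq hdisj
  rw [ncard_image_mul_revPerm] at hunion
  have hle := Set.ncard_le_card (P ∪ (· * Fin.revPerm) '' P)
  rw [Nat.card_eq_fintype_card, Fintype.card_perm, Fintype.card_fin] at hle
  omega

theorem two_mul_ncard_mem_InvSet {n : ℕ} {x : Fin n × Fin n} (hx : x.1 < x.2) :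
    2 * {q : Equiv.Perm (Fin n) | x ∈ InvSet n q}.ncard = n.factorial := by
  have hcompl : (· * Fin.revPerm) '' {q : Equiv.Perm (Fin n) | x ∈ InvSet n q} =
      {q : Equiv.Perm (Fin n) | x ∈ InvSet n q}ᶜ := by
    ext q
    constructor
    · rintro ⟨p, hp, rfl⟩
      exact fun hq => (mem_InvSet_mul_revPerm hx).1 hq hp
    · intro hq
      refine ⟨q * Fin.revPerm, (mem_InvSet_mul_revPerm hx).2 hq, ?_⟩
      ext y
      simp
  have hadd := Set.ncard_add_ncard_compl {q : Equiv.Perm (Fin n) | x ∈ InvSet n q}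
  rw [← hcompl, ncard_image_mul_revPerm, Nat.card_eq_fintype_card, Fintype.card_perm,
    Fintype.card_fin] at hadd
  omega

/-- For `n ≥ 2`, the maximum size of an intersecting family in the weak Bruhat
lattice `B(n)` is `n!/2`, and for every rank-1 permutation `p` the up-set of `p`
is an intersecting family of size exactly `n!/2`; hence `B(n)` has the EKR property. -/
theorem stmt_6 (n : ℕ) (hn : 2 ≤ n) :
    (∀ P : Set (Equiv.Perm (Fin n)), BInter n P → Nat.card P ≤ Nat.factorial n / 2) ∧
    (∀ p : Equiv.Perm (Fin n), brank n p = 1 →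
      BInter n {q | BLE p q} ∧
      Nat.card {q : Equiv.Perm (Fin n) | BLE p q} = Nat.factorial n / 2) := by
  refine ⟨fun P hP => ?_, fun p hp => ⟨fun q hq s hs => ⟨p, ?_, hq, hs⟩, ?_⟩⟩
  · have hle := hP.two_mul_ncard_le
    rw [Nat.card_coe_set_eq]
    omega
  · rintro rfl
    simp [brank, InvSet_one] at hp
  · obtain ⟨x, hx⟩ := Finset.card_eq_one.1 hp
    have hlt : x.1 < x.2 := (mem_InvSet.1 (hx ▸ Finset.mem_singleton_self x)).1
    have hset : {q | BLE p q} = {q | x ∈ InvSet n q} := by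
      ext q
      simp [BLE, hx]
    have hcard := two_mul_ncard_mem_InvSet hlt
    rw [Nat.card_coe_set_eq, hset]
    omega
end
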